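/- Under the stated model, the MRT precoder with relative calibration W_RC = a H_bt* H* + b H_bt* (H_br*)⁻¹ N_u* satisfies E[tr(W_RC W_RCᴴ)] = M K A_t (a² + b² E_2̄^r); consequently the power-normalization parameter equals λ_RC = (M K A_t (a² + b² E_2̄^r))^{-1/2}. -/

import Mathlib

open MeasureTheory ProbabilityTheory Matrix
open scoped NNReal

noncomputable section

/-- The standard circularly symmetric complex Gaussian distribution `CN(0,1)`:
`z = x + i y` with `x, y` independent real Gaussians of mean `0` and variance `1/2`. -/
def cgauss : Measure ℂ :=
  Measure.map (fun p : ℝ × ℝ => (p.1 : ℂ) + (p.2 : ℂ) * Complex.I)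
    ((gaussianReal 0 (1 / 2 : ℝ≥0)).prod (gaussianReal 0 (1 / 2 : ℝ≥0)))

/-- The truncated Gaussian distribution `N_T(m, σ²)` on `[a, b]`: a real Gaussian with mean `m`
and variance `σ²` conditioned on the event of lying in the interval `[a, b]`. -/
def truncGauss (m σ a b : ℝ) : Measure ℝ :=
  ProbabilityTheory.cond (gaussianReal m ⟨σ ^ 2, sq_nonneg σ⟩) (Set.Icc a b)

/-- Canonical sample space of the channel model: the entries of `H`, the entries of `N_u`,
the transmit amplitudes `A_bt`, the transmit phases `φ_bt`, the receive amplitudes `A_br`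
and the receive phases `φ_br`. -/
abbrev ModelΩ (M K : ℕ) :=
  (Fin M → Fin K → ℂ) × (Fin M → Fin K → ℂ) ×
    (Fin M → ℝ) × (Fin M → ℝ) × (Fin M → ℝ) × (Fin M → ℝ)

/-- Joint law of `(H, N_u, A_bt, φ_bt, A_br, φ_br)`: all components are mutually independent,
the entries of `H` and `N_u` are i.i.d. `CN(0,1)`, the transmit (resp. receive) amplitudes are
i.i.d. with law `νt` (resp. `νr`), and the transmit (resp. receive) phases are i.i.d. with law
`μφt` (resp. `μφr`). -/
def modelP (M K : ℕ) (νt νr μφt μφr : Measure ℝ) : Measure (ModelΩ M K) :=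
  (Measure.pi fun _ : Fin M => Measure.pi fun _ : Fin K => cgauss).prod
    ((Measure.pi fun _ : Fin M => Measure.pi fun _ : Fin K => cgauss).prod
      ((Measure.pi fun _ : Fin M => νt).prod
        ((Measure.pi fun _ : Fin M => μφt).prod
          ((Measure.pi fun _ : Fin M => νr).prod (Measure.pi fun _ : Fin M => μφr)))))

/-- The propagation channel matrix `H`. -/
def Hmat {M K : ℕ} (ω : ModelΩ M K) : Matrix (Fin M) (Fin K) ℂ := Matrix.of ω.1

/-- The channel-estimation noise matrix `N_u`. -/
def Nmat {M K : ℕ} (ω : ModelΩ M K) : Matrix (Fin M) (Fin K) ℂ := Matrix.of ω.2.1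

/-- The diagonal transmit RF-frontend response matrix `H_bt`, with `j`-th diagonal entry
`A_bt,j · e^{i φ_bt,j}`. -/
def HbtMat {M K : ℕ} (ω : ModelΩ M K) : Matrix (Fin M) (Fin M) ℂ :=
  Matrix.diagonal fun j => (ω.2.2.1 j : ℂ) * Complex.exp (Complex.I * (ω.2.2.2.1 j : ℂ))

/-- The diagonal receive RF-frontend response matrix `H_br`, with `j`-th diagonal entry
`A_br,j · e^{i φ_br,j}`. -/
def HbrMat {M K : ℕ} (ω : ModelΩ M K) : Matrix (Fin M) (Fin M) ℂ :=
  Matrix.diagonal fun j => (ω.2.2.2.2.1 j : ℂ) * Complex.exp (Complex.I * (ω.2.2.2.2.2 j : ℂ))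

/-- The MRT precoder with inverse calibration:
`W_IC = a H_bt⁻¹ H* + b H_bt⁻¹ (H_br*)⁻¹ N_u*`. -/
def W_IC {M K : ℕ} (a b : ℝ) (ω : ModelΩ M K) : Matrix (Fin M) (Fin K) ℂ :=
  (a : ℂ) • ((HbtMat ω)⁻¹ * (Hmat ω).map (starRingEnd ℂ)) +
    (b : ℂ) • ((HbtMat ω)⁻¹ * ((HbrMat ω).map (starRingEnd ℂ))⁻¹ *
      (Nmat ω).map (starRingEnd ℂ))

/-- The MRT precoder with relative calibration:
`W_RC = a H_bt* H* + b H_bt* (H_br*)⁻¹ N_u*`. -/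
def W_RC {M K : ℕ} (a b : ℝ) (ω : ModelΩ M K) : Matrix (Fin M) (Fin K) ℂ :=
  (a : ℂ) • ((HbtMat ω).map (starRingEnd ℂ) * (Hmat ω).map (starRingEnd ℂ)) +
    (b : ℂ) • ((HbtMat ω).map (starRingEnd ℂ) * ((HbrMat ω).map (starRingEnd ℂ))⁻¹ *
      (Nmat ω).map (starRingEnd ℂ))

instance isProbabilityMeasure_cgauss : IsProbabilityMeasure cgauss :=
  Measure.isProbabilityMeasure_map (by fun_prop)

theorem isProbabilityMeasure_truncGauss {m σ a b : ℝ} (hσ : 0 < σ) (hab : a < b) :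
    IsProbabilityMeasure (truncGauss m σ a b) := by
  have key {v : ℝ≥0} (hv : v ≠ 0) :
      IsProbabilityMeasure (ProbabilityTheory.cond (gaussianReal m v) (Set.Icc a b)) := by
    refine cond_isProbabilityMeasure fun h => ?_
    have := gaussianReal_absolutelyContinuous' m hv h
    simp [hab.not_ge] at this
  exact key fun h0 => (pow_pos hσ 2).ne' (congrArg NNReal.toReal h0)

theorem ae_mem_Icc_truncGauss (m σ a b : ℝ) : ∀ᵐ x ∂truncGauss m σ a b, x ∈ Set.Icc a b :=
  ae_cond_mem measurableSet_Icc

theorem integrable_truncGauss_of_continuousOn {m σ a b : ℝ} {f : ℝ → ℂ} (hσ : 0 < σ)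
    (hab : a < b) (hf : Measurable f) (hc : ContinuousOn f (Set.Icc a b)) :
    Integrable f (truncGauss m σ a b) := by
  have := isProbabilityMeasure_truncGauss (m := m) hσ hab
  obtain ⟨C, hC⟩ := isCompact_Icc.exists_bound_of_continuousOn hc
  refine Integrable.of_bound hf.aestronglyMeasurable C ?_
  filter_upwards [ae_mem_Icc_truncGauss m σ a b] with x hx using hC x hx

theorem integrable_id_cgauss : Integrable (fun z : ℂ => z) cgauss := by
  have h1 : Integrable (fun x : ℝ => (x : ℂ)) (gaussianReal 0 (1 / 2 : ℝ≥0)) :=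
    ((memLp_id_gaussianReal 1).integrable (by norm_num)).ofReal
  refine (integrable_map_measure (by fun_prop) (by fun_prop)).2 ?_
  exact (h1.comp_fst _).add ((h1.comp_snd _).mul_const _)

theorem integral_id_cgauss : ∫ z, z ∂cgauss = 0 := by
  have h1 : Integrable (fun x : ℝ => (x : ℂ)) (gaussianReal 0 (1 / 2 : ℝ≥0)) :=
    ((memLp_id_gaussianReal 1).integrable (by norm_num)).ofReal
  have h0 : ∫ x : ℝ, (x : ℂ) ∂(gaussianReal 0 (1 / 2 : ℝ≥0)) = 0 := by
    rw [integral_complex_ofReal, integral_id_gaussianReal, Complex.ofReal_zero]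
  rw [cgauss, integral_map (by fun_prop) (by fun_prop),
    integral_add (h1.comp_fst _) ((h1.comp_snd _).mul_const _), integral_mul_const,
    integral_fun_fst (fun x : ℝ => (x : ℂ)), integral_fun_snd (fun x : ℝ => (x : ℂ)), h0]
  simp

theorem integrable_conj_cgauss : Integrable (fun z : ℂ => starRingEnd ℂ z) cgauss :=
  Complex.conjCLE.toContinuousLinearMap.integrable_comp integrable_id_cgauss

theorem integral_conj_cgauss : ∫ z, starRingEnd ℂ z ∂cgauss = 0 := by
  rw [integral_conj, integral_id_cgauss, map_zero]

theorem integrable_sq_gaussianReal (v : ℝ≥0) :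
    Integrable (fun x : ℝ => ((x ^ 2 : ℝ) : ℂ)) (gaussianReal 0 v) :=
  ((memLp_id_gaussianReal 2).integrable_sq).ofReal

theorem integral_sq_gaussianReal (v : ℝ≥0) :
    ∫ x : ℝ, ((x ^ 2 : ℝ) : ℂ) ∂(gaussianReal 0 v) = (v : ℝ) := by
  have h := variance_fun_id_gaussianReal (μ := 0) (v := v)
  rw [variance_eq_integral (by fun_prop), integral_id_gaussianReal] at h
  rw [integral_complex_ofReal, ← h]
  simp

theorem mul_conj_add_mul_I (x y : ℝ) :
    ((x : ℂ) + y * Complex.I) * starRingEnd ℂ ((x : ℂ) + y * Complex.I) =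
      ((x ^ 2 : ℝ) : ℂ) + ((y ^ 2 : ℝ) : ℂ) := by
  rw [Complex.mul_conj, Complex.normSq_add_mul_I]
  push_cast
  rfl

theorem integrable_mul_conj_cgauss :
    Integrable (fun z : ℂ => z * starRingEnd ℂ z) cgauss := by
  refine (integrable_map_measure (by fun_prop) (by fun_prop)).2 ?_
  simp only [Function.comp_def, mul_conj_add_mul_I]
  exact ((integrable_sq_gaussianReal _).comp_fst _).add
    ((integrable_sq_gaussianReal _).comp_snd _)

theorem integral_mul_conj_cgauss : ∫ z, z * starRingEnd ℂ z ∂cgauss = 1 := by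
  rw [cgauss, integral_map (by fun_prop) (by fun_prop)]
  simp only [mul_conj_add_mul_I]
  rw [integral_add ((integrable_sq_gaussianReal _).comp_fst _)
      ((integrable_sq_gaussianReal _).comp_snd _),
    integral_fun_fst (fun x : ℝ => ((x ^ 2 : ℝ) : ℂ)),
    integral_fun_snd (fun x : ℝ => ((x ^ 2 : ℝ) : ℂ)), integral_sq_gaussianReal]
  norm_num

theorem integrable_comp_entry_cgauss {M K : ℕ} (j : Fin M) (k : Fin K) {h : ℂ → ℂ}
    (hh : Integrable h cgauss) :
    Integrable (fun x : Fin M → Fin K → ℂ => h (x j k))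
      (Measure.pi fun _ : Fin M => Measure.pi fun _ : Fin K => cgauss) :=
  integrable_comp_eval (X := fun _ => Fin K → ℂ) (i := j) (f := fun y => h (y k))
    (integrable_comp_eval (i := k) hh)

theorem integral_comp_entry_cgauss {M K : ℕ} (j : Fin M) (k : Fin K) {h : ℂ → ℂ}
    (hh : Integrable h cgauss) :
    ∫ x : Fin M → Fin K → ℂ, h (x j k)
      ∂(Measure.pi fun _ : Fin M => Measure.pi fun _ : Fin K => cgauss) =
      ∫ z, h z ∂cgauss := by
  rw [integral_comp_eval (X := fun _ => Fin K → ℂ) (i := j) (f := fun y => h (y k))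
    (integrable_comp_eval (i := k) hh).aestronglyMeasurable,
    integral_comp_eval (i := k) hh.aestronglyMeasurable]

section Model

variable {M K : ℕ} {νt νr μφt μφr : Measure ℝ} [IsProbabilityMeasure νt]
  [IsProbabilityMeasure νr] [IsProbabilityMeasure μφt] [IsProbabilityMeasure μφr]

/-- Product of functions of the individual coordinates entering the `(j, k)` entry of the
precoder, in the case where it does not depend on the transmit phase. -/
def coordProd (j : Fin M) (k : Fin K) (f g : ℂ → ℂ) (p r s : ℝ → ℂ) (ω : ModelΩ M K) : ℂ :=
  f (ω.1 j k) * (g (ω.2.1 j k) * (p (ω.2.2.1 j) * (1 * (r (ω.2.2.2.2.1 j) *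
    s (ω.2.2.2.2.2 j)))))

theorem integrable_coordProd (j : Fin M) (k : Fin K) {f g : ℂ → ℂ} {p r s : ℝ → ℂ}
    (hf : Integrable f cgauss) (hg : Integrable g cgauss) (hp : Integrable p νt)
    (hr : Integrable r νr) (hs : Integrable s μφr) :
    Integrable (coordProd j k f g p r s) (modelP M K νt νr μφt μφr) := by
  have hrs := (integrable_comp_eval (i := j) (μ := fun _ : Fin M => νr) hr).mul_prod
    (integrable_comp_eval (i := j) (μ := fun _ : Fin M => μφr) hs)
  have hrs' := (integrable_const (μ := Measure.pi fun _ : Fin M => μφt) (1 : ℂ)).mul_prod hrs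
  have hprs := (integrable_comp_eval (i := j) (μ := fun _ : Fin M => νt) hp).mul_prod hrs'
  have hgprs := (integrable_comp_entry_cgauss j k hg).mul_prod hprs
  exact (integrable_comp_entry_cgauss j k hf).mul_prod hgprs

theorem integral_coordProd (j : Fin M) (k : Fin K) {f g : ℂ → ℂ} {p r s : ℝ → ℂ}
    (hf : Integrable f cgauss) (hg : Integrable g cgauss) (hp : Integrable p νt)
    (hr : Integrable r νr) (hs : Integrable s μφr) :
    ∫ ω, coordProd j k f g p r s ω ∂modelP M K νt νr μφt μφr =
      (∫ z, f z ∂cgauss) * ((∫ z, g z ∂cgauss) *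
        ((∫ x, p x ∂νt) * ((∫ x, r x ∂νr) * ∫ x, s x ∂μφr))) := by
  simp only [coordProd, modelP]
  rw [integral_prod_mul (fun x : Fin M → Fin K → ℂ => f (x j k))
      (fun y : (Fin M → Fin K → ℂ) × (Fin M → ℝ) × (Fin M → ℝ) × (Fin M → ℝ) × (Fin M → ℝ) =>
        g (y.1 j k) * (p (y.2.1 j) * (1 * (r (y.2.2.2.1 j) * s (y.2.2.2.2 j))))),
    integral_prod_mul (fun x : Fin M → Fin K → ℂ => g (x j k))
      (fun y : (Fin M → ℝ) × (Fin M → ℝ) × (Fin M → ℝ) × (Fin M → ℝ) =>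
        p (y.1 j) * (1 * (r (y.2.2.1 j) * s (y.2.2.2 j)))),
    integral_prod_mul (fun x : Fin M → ℝ => p (x j))
      (fun y : (Fin M → ℝ) × (Fin M → ℝ) × (Fin M → ℝ) =>
        1 * (r (y.2.1 j) * s (y.2.2 j))),
    integral_prod_mul (fun _ : Fin M → ℝ => (1 : ℂ))
      (fun y : (Fin M → ℝ) × (Fin M → ℝ) => r (y.1 j) * s (y.2 j)),
    integral_prod_mul (fun x : Fin M → ℝ => r (x j)) (fun x : Fin M → ℝ => s (x j)),
    integral_comp_entry_cgauss j k hf, integral_comp_entry_cgauss j k hg, integral_comp_eval hp.aestronglyMeasurable,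
    integral_comp_eval hr.aestronglyMeasurable, integral_comp_eval hs.aestronglyMeasurable]
  simp

theorem ae_receive_amplitude (hr : ∀ᵐ x ∂νr, x ≠ 0) :
    ∀ᵐ ω ∂modelP M K νt νr μφt μφr, ∀ j, ω.2.2.2.2.1 j ≠ 0 := by
  refine ae_all_iff.2 fun j => ?_
  have hmp : MeasurePreserving (fun ω : ModelΩ M K => ω.2.2.2.2.1 j)
      (modelP M K νt νr μφt μφr) νr :=
    (measurePreserving_eval (fun _ : Fin M => νr) j).comp <| measurePreserving_fst.comp <|
      measurePreserving_snd.comp <| measurePreserving_snd.comp <|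
        measurePreserving_snd.comp measurePreserving_snd
  exact hmp.quasiMeasurePreserving.ae hr

end Model

/-- The squared modulus of the `(j, k)` entry of `W_RC`, expanded. -/
def entryPower {M K : ℕ} (a b : ℝ) (j : Fin M) (k : Fin K) (ω : ModelΩ M K) : ℂ :=
  (a : ℂ) ^ 2 * coordProd j k (fun z => z * starRingEnd ℂ z) (fun _ => 1)
      (fun x => ((x ^ 2 : ℝ) : ℂ)) (fun _ => 1) (fun _ => 1) ω +
    (b : ℂ) ^ 2 * coordProd j k (fun _ => 1) (fun z => z * starRingEnd ℂ z)
      (fun x => ((x ^ 2 : ℝ) : ℂ)) (fun x => (((x ^ 2)⁻¹ : ℝ) : ℂ)) (fun _ => 1) ω +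
    ((a : ℂ) * b * coordProd j k (starRingEnd ℂ) (fun z => z)
      (fun x => ((x ^ 2 : ℝ) : ℂ)) (fun x => ((x⁻¹ : ℝ) : ℂ))
      (fun x => Complex.exp (-(Complex.I * x))) ω +
    (a : ℂ) * b * coordProd j k (fun z => z) (starRingEnd ℂ)
      (fun x => ((x ^ 2 : ℝ) : ℂ)) (fun x => ((x⁻¹ : ℝ) : ℂ))
      (fun x => Complex.exp (Complex.I * x)) ω)

theorem W_RC_apply {M K : ℕ} (a b : ℝ) {ω : ModelΩ M K} (hω : ∀ j, ω.2.2.2.2.1 j ≠ 0)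
    (j : Fin M) (k : Fin K) :
    W_RC a b ω j k = (ω.2.2.1 j : ℂ) * Complex.exp (-(Complex.I * (ω.2.2.2.1 j : ℂ))) *
      (a * starRingEnd ℂ (ω.1 j k) + b * ((ω.2.2.2.2.1 j : ℂ)⁻¹ *
        Complex.exp (Complex.I * (ω.2.2.2.2.2 j : ℂ))) * starRingEnd ℂ (ω.2.1 j k)) := by
  have hinv : ((HbrMat ω).map (starRingEnd ℂ))⁻¹ = Matrix.diagonal fun j =>
      (ω.2.2.2.2.1 j : ℂ)⁻¹ * Complex.exp (Complex.I * (ω.2.2.2.2.2 j : ℂ)) := by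
    refine Matrix.inv_eq_right_inv ?_
    rw [HbrMat, Matrix.diagonal_map (map_zero _), Matrix.diagonal_mul_diagonal,
      ← Matrix.diagonal_one]
    congr 1
    funext i
    have h : (ω.2.2.2.2.1 i : ℂ) ≠ 0 := Complex.ofReal_ne_zero.2 (hω i)
    simp only [map_mul, Complex.conj_ofReal, ← Complex.exp_conj,
      Complex.conj_I, neg_mul, Complex.exp_neg]
    field_simp [Complex.exp_ne_zero]
  rw [W_RC, hinv, HbtMat, Matrix.diagonal_map (map_zero _), Matrix.diagonal_mul_diagonal]
  simp only [Matrix.add_apply, Matrix.smul_apply, Matrix.diagonal_mul, Matrix.map_apply,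
    Hmat, Nmat, Matrix.of_apply, smul_eq_mul, map_mul,
    Complex.conj_ofReal, ← Complex.exp_conj, Complex.conj_I, neg_mul]
  ring

theorem trace_W_RC {M K : ℕ} (a b : ℝ) {ω : ModelΩ M K} (hω : ∀ j, ω.2.2.2.2.1 j ≠ 0) :
    Matrix.trace (W_RC a b ω * (W_RC a b ω)ᴴ) = ∑ j, ∑ k, entryPower a b j k ω := by
  simp only [Matrix.trace, Matrix.diag_apply, Matrix.mul_apply, Matrix.conjTranspose_apply]
  refine Finset.sum_congr rfl fun j _ => Finset.sum_congr rfl fun k _ => ?_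
  have h : (ω.2.2.2.2.1 j : ℂ) ≠ 0 := Complex.ofReal_ne_zero.2 (hω j)
  simp only [W_RC_apply a b hω, entryPower, coordProd, RCLike.star_def, map_add, map_mul,
    map_inv₀, Complex.conj_ofReal, ← Complex.exp_conj, Complex.conj_I, neg_mul,
    Complex.conj_conj, Complex.exp_neg, Complex.ofReal_pow, Complex.ofReal_inv]
  field_simp [Complex.exp_ne_zero]
  ring

theorem integrable_exp_mul {μ : Measure ℝ} [IsProbabilityMeasure μ] :
    Integrable (fun x : ℝ => Complex.exp (Complex.I * x)) μ := by
  refine Integrable.of_bound (by fun_prop) 1 (ae_of_all _ fun x => ?_)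
  rw [mul_comm, Complex.norm_exp_ofReal_mul_I]

theorem integrable_exp_neg_mul {μ : Measure ℝ} [IsProbabilityMeasure μ] :
    Integrable (fun x : ℝ => Complex.exp (-(Complex.I * x))) μ := by
  refine Integrable.of_bound (by fun_prop) 1 (ae_of_all _ fun x => ?_)
  rw [← mul_neg, ← Complex.ofReal_neg, mul_comm, Complex.norm_exp_ofReal_mul_I]

section EntryPower

variable {M K : ℕ} {νt νr μφt μφr : Measure ℝ} [IsProbabilityMeasure νt]
  [IsProbabilityMeasure νr] [IsProbabilityMeasure μφt] [IsProbabilityMeasure μφr]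

theorem integrable_entryPower (a b : ℝ) (j : Fin M) (k : Fin K)
    (ht : Integrable (fun x : ℝ => ((x ^ 2 : ℝ) : ℂ)) νt)
    (hr2 : Integrable (fun x : ℝ => (((x ^ 2)⁻¹ : ℝ) : ℂ)) νr)
    (hr1 : Integrable (fun x : ℝ => ((x⁻¹ : ℝ) : ℂ)) νr) :
    Integrable (entryPower a b j k) (modelP M K νt νr μφt μφr) :=
  (((integrable_coordProd j k integrable_mul_conj_cgauss (integrable_const _) ht
        (integrable_const _) (integrable_const _)).const_mul _).add
      ((integrable_coordProd j k (integrable_const _) integrable_mul_conj_cgauss ht hr2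
        (integrable_const _)).const_mul _)).add
    (((integrable_coordProd j k integrable_conj_cgauss integrable_id_cgauss ht hr1
        integrable_exp_neg_mul).const_mul _).add
      ((integrable_coordProd j k integrable_id_cgauss integrable_conj_cgauss ht hr1
        integrable_exp_mul).const_mul _))

theorem integral_entryPower (a b : ℝ) (j : Fin M) (k : Fin K)
    (ht : Integrable (fun x : ℝ => ((x ^ 2 : ℝ) : ℂ)) νt)
    (hr2 : Integrable (fun x : ℝ => (((x ^ 2)⁻¹ : ℝ) : ℂ)) νr)
    (hr1 : Integrable (fun x : ℝ => ((x⁻¹ : ℝ) : ℂ)) νr) :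
    ∫ ω, entryPower a b j k ω ∂modelP M K νt νr μφt μφr =
      (∫ x, x ^ 2 ∂νt : ℝ) * (a ^ 2 + b ^ 2 * (∫ x, (x ^ 2)⁻¹ ∂νr : ℝ)) := by
  have h1 := integrable_coordProd (μφt := μφt) (μφr := μφr) j k integrable_mul_conj_cgauss
    (integrable_const (1 : ℂ)) ht (νr := νr) (integrable_const (1 : ℂ))
    (integrable_const (1 : ℂ))
  have h2 := integrable_coordProd (μφt := μφt) (μφr := μφr) j k (integrable_const (1 : ℂ))
    integrable_mul_conj_cgauss ht hr2 (integrable_const (1 : ℂ))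
  have h3 := integrable_coordProd (μφt := μφt) (μφr := μφr) j k integrable_conj_cgauss
    integrable_id_cgauss ht hr1 integrable_exp_neg_mul
  have h4 := integrable_coordProd (μφt := μφt) (μφr := μφr) j k integrable_id_cgauss
    integrable_conj_cgauss ht hr1 integrable_exp_mul
  refine (integral_add ((h1.const_mul ((a : ℂ) ^ 2)).add (h2.const_mul ((b : ℂ) ^ 2)))
    ((h3.const_mul ((a : ℂ) * b)).add (h4.const_mul ((a : ℂ) * b)))).trans ?_
  rw [integral_add' (h1.const_mul _) (h2.const_mul _),
    integral_add' (h3.const_mul _) (h4.const_mul _)]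
  simp only [integral_const_mul]
  rw [integral_coordProd j k integrable_mul_conj_cgauss (integrable_const _) ht
      (integrable_const _) (integrable_const _),
    integral_coordProd j k (integrable_const _) integrable_mul_conj_cgauss ht hr2
      (integrable_const _),
    integral_coordProd j k integrable_conj_cgauss integrable_id_cgauss ht hr1
      integrable_exp_neg_mul,
    integral_coordProd j k integrable_id_cgauss integrable_conj_cgauss ht hr1
      integrable_exp_mul,
    integral_mul_conj_cgauss, integral_conj_cgauss, integral_id_cgauss]
  simp only [integral_complex_ofReal, integral_const, probReal_univ, one_smul]
  ring

end EntryPower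

/-- `E[tr(W_RC W_RCᴴ)] = M K A_t (a² + b² E_2̄^r)`, and consequently the power-normalization
parameter equals `λ_RC = (M K A_t (a² + b² E_2̄^r))^{-1/2}`. -/
theorem relative_calibration_power_normalization
    (M K : ℕ) (hM : 0 < M) (hK : 0 < K)
    (a b : ℝ) (hab : a ≠ 0 ∨ b ≠ 0)
    (mt σt ct dt mr σr cr dr : ℝ)
    (hσt : 0 < σt) (hct : 0 < ct) (hctdt : ct < dt)
    (hσr : 0 < σr) (hcr : 0 < cr) (hcrdr : cr < dr)
    (μφt μφr : Measure ℝ) [IsProbabilityMeasure μφt] [IsProbabilityMeasure μφr]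
    (At E2r : ℝ)
    (hAt : At = ∫ x, x ^ 2 ∂truncGauss mt σt ct dt)
    (hE2r : E2r = ∫ x, (x ^ 2)⁻¹ ∂truncGauss mr σr cr dr) :
    (∫ ω, Matrix.trace (W_RC a b ω * (W_RC a b ω)ᴴ)
        ∂modelP M K (truncGauss mt σt ct dt) (truncGauss mr σr cr dr) μφt μφr) =
      ((M : ℂ) * K * At * (a ^ 2 + b ^ 2 * E2r)) ∧
    (Real.sqrt (∫ ω, (Matrix.trace (W_RC a b ω * (W_RC a b ω)ᴴ)).re
        ∂modelP M K (truncGauss mt σt ct dt) (truncGauss mr σr cr dr) μφt μφr))⁻¹ =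
      (Real.sqrt ((M : ℝ) * K * At * (a ^ 2 + b ^ 2 * E2r)))⁻¹ := by
  have := isProbabilityMeasure_truncGauss (m := mt) hσt hctdt
  have := isProbabilityMeasure_truncGauss (m := mr) hσr hcrdr
  have hne : ∀ x ∈ Set.Icc cr dr, x ≠ 0 := fun x hx => (hcr.trans_le hx.1).ne'
  have ht : Integrable (fun x : ℝ => ((x ^ 2 : ℝ) : ℂ)) (truncGauss mt σt ct dt) :=
    integrable_truncGauss_of_continuousOn hσt hctdt (by fun_prop) (by fun_prop)
  have hr1 : Integrable (fun x : ℝ => ((x⁻¹ : ℝ) : ℂ)) (truncGauss mr σr cr dr) :=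
    integrable_truncGauss_of_continuousOn hσr hcrdr (by fun_prop)
      (Complex.continuous_ofReal.comp_continuousOn (continuousOn_id.inv₀ hne))
  have hr2 : Integrable (fun x : ℝ => (((x ^ 2)⁻¹ : ℝ) : ℂ)) (truncGauss mr σr cr dr) :=
    integrable_truncGauss_of_continuousOn hσr hcrdr (by fun_prop)
      (Complex.continuous_ofReal.comp_continuousOn
        ((continuousOn_pow 2).inv₀ fun x hx => pow_ne_zero 2 (hne x hx)))
  have hae : (fun ω => Matrix.trace (W_RC a b ω * (W_RC a b ω)ᴴ))
      =ᵐ[modelP M K (truncGauss mt σt ct dt) (truncGauss mr σr cr dr) μφt μφr]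
        fun ω => ∑ j, ∑ k, entryPower a b j k ω := by
    filter_upwards [ae_receive_amplitude
      ((ae_mem_Icc_truncGauss mr σr cr dr).mono hne)] with ω hω using trace_W_RC a b hω
  have hint := fun (j : Fin M) (k : Fin K) =>
    integrable_entryPower (μφt := μφt) (μφr := μφr) a b j k ht hr2 hr1
  have hsum := integrable_finsetSum Finset.univ fun j _ =>
    integrable_finsetSum Finset.univ fun k _ => hint j k
  have hmain : (∫ ω, Matrix.trace (W_RC a b ω * (W_RC a b ω)ᴴ)
      ∂modelP M K (truncGauss mt σt ct dt) (truncGauss mr σr cr dr) μφt μφr) =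
      ((M : ℂ) * K * At * (a ^ 2 + b ^ 2 * E2r)) := by
    rw [integral_congr_ae hae, integral_finsetSum _ fun j _ =>
      integrable_finsetSum Finset.univ fun k _ => hint j k]
    simp only [integral_finsetSum _ fun k _ => hint _ k,
      integral_entryPower a b _ _ ht hr2 hr1, ← hAt, ← hE2r, Finset.sum_const,
      Finset.card_univ, Fintype.card_fin, nsmul_eq_mul]
    ring
  refine ⟨hmain, ?_⟩
  have hre := integral_re (hsum.congr hae.symm)
  simp only [RCLike.re_to_complex] at hre
  rw [hre, hmain, ← Complex.ofReal_re ((M : ℝ) * K * At * (a ^ 2 + b ^ 2 * E2r))]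
  push_cast
  rfl
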